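/- Let X have i.i.d. rows N(0, Σ) with Σ_{jj} = 1 for all j. If p < exp(n/(4C₂²)) with C₂ > 4√(5/3), then with probability at least 1 − 1/p², every entry of Δ = XᵀX/n − Σ satisfies |Δ_{jk}| < C₂√(log p / n). -/

import Mathlib

open MeasureTheory ProbabilityTheory Finset

/-- The Padé upper bound for `log (1 + x)` on the nonnegative half-line. -/
theorem log_one_add_le_pade {x : ℝ} (hx : 0 ≤ x) :
    Real.log (1 + x) ≤ x * (6 + x) / (6 + 4 * x) := by
  let f : ℝ → ℝ := fun y => y * (6 + y) / (6 + 4 * y) - Real.log (1 + y)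
  have hderiv : ∀ y : ℝ, 0 ≤ y →
      HasDerivAt f (((1 * (6 + y) + y * 1) * (6 + 4 * y) - y * (6 + y) * (4 * 1)) /
        (6 + 4 * y) ^ 2 - 1 / (1 + y)) y := by
    intro y hy
    have hnum : HasDerivAt (fun y : ℝ => y * (6 + y)) (1 * (6 + y) + y * 1) y :=
      (hasDerivAt_id y).mul ((hasDerivAt_id y).const_add 6)
    have hden : HasDerivAt (fun y : ℝ => 6 + 4 * y) (4 * 1) y :=
      ((hasDerivAt_id y).const_mul 4).const_add 6
    have hlog : HasDerivAt (fun y : ℝ => Real.log (1 + y)) (1 / (1 + y)) y :=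
      ((hasDerivAt_id y).const_add 1).log (by positivity)
    exact (hnum.div hden (by positivity)).sub hlog
  have hmono : MonotoneOn f (Set.Ici 0) := by
    refine monotoneOn_of_deriv_nonneg (convex_Ici 0)
      (fun y hy => (hderiv y hy).continuousAt.continuousWithinAt)
      (fun y hy => ?_) (fun y hy => ?_)
    · rw [interior_Ici] at hy
      exact (hderiv y (le_of_lt hy)).differentiableAt.differentiableWithinAt
    · rw [interior_Ici] at hy
      have hy0 : 0 < y := hy
      rw [(hderiv y hy0.le).deriv]
      have heq : ((1 * (6 + y) + y * 1) * (6 + 4 * y) - y * (6 + y) * (4 * 1)) /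
          (6 + 4 * y) ^ 2 - 1 / (1 + y) = 4 * y ^ 3 / ((6 + 4 * y) ^ 2 * (1 + y)) := by
        field_simp
        ring
      rw [heq]
      positivity
  have h := hmono (Set.self_mem_Ici) (Set.mem_Ici.2 hx) hx
  simp only [f, zero_mul, zero_div, add_zero, Real.log_one, sub_zero] at h
  linarith

theorem log_one_add_le_sub_sq {x : ℝ} (hx : 0 ≤ x) (hx' : x ≤ 1 / 2) :
    Real.log (1 + x) ≤ x - 3 / 8 * x ^ 2 := by
  refine (log_one_add_le_pade hx).trans ?_
  rw [div_le_iff₀ (by positivity)]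
  nlinarith [mul_nonneg (sq_nonneg x) (sub_nonneg.2 hx')]

/-- The moment generating function `exp (-s) / √(1 - 2s)` of a centered `χ²₁` variable is at least
as large on the right as on the left. -/
theorem exp_div_sqrt_neg_le {t : ℝ} (ht : 0 ≤ t) (ht' : t < 1 / 2) :
    Real.exp t * (√(1 + 2 * t))⁻¹ ≤ Real.exp (-t) * (√(1 - 2 * t))⁻¹ := by
  have hlog : 4 * t ≤ Real.log (1 + 2 * t) - Real.log (1 - 2 * t) := by
    have hs := Real.hasSum_log_sub_log_of_abs_lt_one (x := 2 * t) (by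
      rw [abs_of_nonneg (by positivity)]; linarith)
    have := le_hasSum hs 0 (fun k _ => by positivity)
    norm_num at this
    linarith
  have h1 : 0 < 1 + 2 * t := by linarith
  have h2 : 0 < 1 - 2 * t := by linarith
  have hexp : ∀ y : ℝ, 0 < y → (√y)⁻¹ = Real.exp (-(Real.log y / 2)) := by
    intro y hy
    rw [Real.exp_neg, ← Real.log_sqrt hy.le, Real.exp_log (Real.sqrt_pos.2 hy)]
  rw [hexp _ h1, hexp _ h2, ← Real.exp_add, ← Real.exp_add, Real.exp_le_exp]
  linarith

/-- The moment generating function of a `χ²₁` variable. -/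
theorem mgf_sq_div_gaussianReal {v : NNReal} (hv : v ≠ 0) {s : ℝ} (hs : s < 1 / 2) :
    mgf (fun x => x ^ 2 / (v : ℝ)) (gaussianReal 0 v) s = (√(1 - 2 * s))⁻¹ := by
  have hv0 : (0 : ℝ) < v := by positivity
  have hs0 : 0 < 1 - 2 * s := by linarith
  have hdens : ∀ x : ℝ, gaussianPDFReal 0 v x • Real.exp (s * (x ^ 2 / (v : ℝ))) =
      (√(2 * Real.pi * v))⁻¹ * Real.exp (-((1 - 2 * s) / (2 * v)) * x ^ 2) := by
    intro x
    rw [gaussianPDFReal, smul_eq_mul, mul_assoc, ← Real.exp_add]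
    congr 2
    field_simp
    ring
  rw [mgf, integral_gaussianReal_eq_integral_smul hv]
  simp_rw [hdens]
  rw [integral_const_mul, integral_gaussian, ← Real.sqrt_inv, ← Real.sqrt_mul (by positivity),
    ← Real.sqrt_inv]
  congr 1
  field_simp

section Law

variable {Ω : Type*} [MeasurableSpace Ω] {μ : Measure Ω}

theorem mgf_sq_div_of_hasLaw {Z : Ω → ℝ} {c : ℝ} (hc : 0 < c)
    (hZ : HasLaw Z (gaussianReal 0 c.toNNReal) μ) {s : ℝ} (hs : s < 1 / 2) :
    mgf (fun ω => Z ω ^ 2 / c) μ s = (√(1 - 2 * s))⁻¹ := by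
  have h := mgf_sq_div_gaussianReal (Real.toNNReal_pos.2 hc).ne' hs
  rw [← hZ.map_eq, mgf_map hZ.aemeasurable (by fun_prop), Real.coe_toNNReal _ hc.le] at h
  exact h

theorem ae_sq_eq_mul_sq_div_of_hasLaw {Z : Ω → ℝ} {c : ℝ}
    (hZ : HasLaw Z (gaussianReal 0 c.toNNReal) μ) (hc : 0 ≤ c) :
    ∀ᵐ ω ∂μ, Z ω ^ 2 = c * (Z ω ^ 2 / c) := by
  rcases hc.eq_or_lt with rfl | hc
  · have h : ∀ᵐ x ∂(μ.map Z), x = 0 := by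
      rw [hZ.map_eq]
      simp
    filter_upwards [ae_of_ae_map hZ.aemeasurable h] with ω hω
    simp [hω]
  · exact ae_of_all _ fun ω => by field_simp

theorem ae_exp_sq_sub_sq_le {Q D : Ω → ℝ} {a b : ℝ} (ha : 0 ≤ a) (hb : 0 ≤ b) (hab : a + b = 1)
    (hQ : HasLaw Q (gaussianReal 0 (4 * a).toNNReal) μ)
    (hD : HasLaw D (gaussianReal 0 (4 * b).toNNReal) μ) (t : ℝ) :
    ∀ᵐ ω ∂μ, Real.exp (t * ((Q ω ^ 2 - D ω ^ 2) / 4 - (a - b))) ≤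
      a * Real.exp (t * (Q ω ^ 2 / (4 * a) - 1)) +
        b * Real.exp (-t * (D ω ^ 2 / (4 * b) - 1)) := by
  filter_upwards [ae_sq_eq_mul_sq_div_of_hasLaw hQ (by positivity),
    ae_sq_eq_mul_sq_div_of_hasLaw hD (by positivity)] with ω hq hd
  have hconv := convexOn_exp.2 (Set.mem_univ (t * (Q ω ^ 2 / (4 * a) - 1)))
    (Set.mem_univ (-t * (D ω ^ 2 / (4 * b) - 1))) ha hb hab
  simp only [smul_eq_mul] at hconv
  refine le_trans (le_of_eq ?_) hconv
  congr 1
  linear_combination t / 4 * hq - t / 4 * hd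

variable [IsProbabilityMeasure μ]

theorem integrable_exp_sq_div_of_hasLaw {Z : Ω → ℝ} {c : ℝ} (hc : 0 ≤ c)
    (hZ : HasLaw Z (gaussianReal 0 c.toNNReal) μ) {s : ℝ} (hs : s < 1 / 2) :
    Integrable (fun ω => Real.exp (s * (Z ω ^ 2 / c - 1))) μ := by
  rcases hc.eq_or_lt with rfl | hc
  · simp
  · have hint : Integrable (fun ω => Real.exp (s * (Z ω ^ 2 / c))) μ := by
      refine not_imp_comm.1 integral_undef ?_
      have h := mgf_sq_div_of_hasLaw hc hZ hs
      rw [mgf] at h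
      rw [h]
      exact (inv_pos.2 (Real.sqrt_pos.2 (by linarith))).ne'
    refine (hint.const_mul (Real.exp (-s))).congr (ae_of_all _ fun ω => ?_)
    simp only [← Real.exp_add]
    congr 1
    ring

theorem mul_integral_exp_sq_div_of_hasLaw {Z : Ω → ℝ} {c : ℝ} (hc : 0 ≤ c)
    (hZ : HasLaw Z (gaussianReal 0 c.toNNReal) μ) {s : ℝ} (hs : s < 1 / 2) :
    c * ∫ ω, Real.exp (s * (Z ω ^ 2 / c - 1)) ∂μ =
      c * (Real.exp (-s) * (√(1 - 2 * s))⁻¹) := by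
  rcases hc.eq_or_lt with rfl | hc
  · simp
  · have h := mgf_sq_div_of_hasLaw hc hZ hs
    have hexp : ∀ ω, Real.exp (s * (Z ω ^ 2 / c - 1)) =
        Real.exp (-s) * Real.exp (s * (Z ω ^ 2 / c)) := by
      intro ω
      rw [← Real.exp_add]
      congr 1
      ring
    rw [mgf] at h
    simp_rw [hexp]
    rw [integral_const_mul, h]

theorem integrable_exp_sq_sub_sq {Q D : Ω → ℝ} {a b : ℝ} (ha : 0 ≤ a) (hb : 0 ≤ b)
    (hab : a + b = 1)
    (hQ : HasLaw Q (gaussianReal 0 (4 * a).toNNReal) μ)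
    (hD : HasLaw D (gaussianReal 0 (4 * b).toNNReal) μ) {t : ℝ} (ht : 0 ≤ t) (ht' : t < 1 / 2) :
    Integrable (fun ω => Real.exp (t * ((Q ω ^ 2 - D ω ^ 2) / 4 - (a - b)))) μ := by
  have hF := integrable_exp_sq_div_of_hasLaw (by positivity) hQ ht'
  have hG := integrable_exp_sq_div_of_hasLaw (by positivity) hD (s := -t) (by linarith)
  have hQm := hQ.aemeasurable
  have hDm := hD.aemeasurable
  refine ((hF.const_mul a).add (hG.const_mul b)).mono'
    (AEMeasurable.aestronglyMeasurable (by fun_prop)) ?_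
  filter_upwards [ae_exp_sq_sub_sq_le ha hb hab hQ hD t] with ω hω
  rwa [Real.norm_of_nonneg (Real.exp_pos _).le]

/-- If `Q ∼ N(0, 4a)` and `D ∼ N(0, 4b)` with `a + b = 1`, with an arbitrary joint law, then the
moment generating function of the centered variable `(Q² - D²)/4` is dominated by that of a
centered `χ²₁` variable. -/
theorem mgf_sq_sub_sq_le {Q D : Ω → ℝ} {a b : ℝ} (ha : 0 ≤ a) (hb : 0 ≤ b) (hab : a + b = 1)
    (hQ : HasLaw Q (gaussianReal 0 (4 * a).toNNReal) μ)
    (hD : HasLaw D (gaussianReal 0 (4 * b).toNNReal) μ) {t : ℝ} (ht : 0 ≤ t) (ht' : t < 1 / 2) :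
    mgf (fun ω => (Q ω ^ 2 - D ω ^ 2) / 4 - (a - b)) μ t ≤
      Real.exp (-t) * (√(1 - 2 * t))⁻¹ := by
  have hF := integrable_exp_sq_div_of_hasLaw (by positivity) hQ ht'
  have hG := integrable_exp_sq_div_of_hasLaw (by positivity) hD (s := -t) (by linarith)
  have hFi := mul_integral_exp_sq_div_of_hasLaw (by positivity) hQ ht'
  have hGi := mul_integral_exp_sq_div_of_hasLaw (by positivity) hD (s := -t) (by linarith)
  have hle := integral_mono_ae (integrable_exp_sq_sub_sq ha hb hab hQ hD ht ht')
    ((hF.const_mul a).add (hG.const_mul b)) (ae_exp_sq_sub_sq_le ha hb hab hQ hD t)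
  simp only [Pi.add_apply] at hle
  rw [integral_add (hF.const_mul a) (hG.const_mul b), integral_const_mul, integral_const_mul] at hle
  have hneg := mul_le_mul_of_nonneg_left (exp_div_sqrt_neg_le ht ht') hb
  rw [neg_neg, show 1 - 2 * -t = 1 + 2 * t by ring] at hGi
  refine hle.trans ?_
  set K := Real.exp (-t) * (√(1 - 2 * t))⁻¹
  have hK : a * K + b * K = K := by rw [← add_mul, hab, one_mul]
  linarith

/-- Chernoff bound for a sum of i.i.d. copies of `Y`, realized on a finite power of `μ`. -/
theorem pi_measureReal_ge_le {n : ℕ} {Y : Ω → ℝ} (hY : Measurable Y) {t M : ℝ} (ht : 0 ≤ t)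
    (hint : Integrable (fun ω => Real.exp (t * Y ω)) μ) (hM : mgf Y μ t ≤ M) (r : ℝ) :
    (Measure.pi (fun _ : Fin n => μ)).real {x | n * r ≤ ∑ i, Y (x i)} ≤
      (Real.exp (-t * r) * M) ^ n := by
  have hind : iIndepFun (fun (i : Fin n) (x : Fin n → Ω) => Y (x i))
      (Measure.pi (fun _ : Fin n => μ)) := iIndepFun_pi (fun _ => hY.aemeasurable)
  have hmeas : ∀ i : Fin n, Measurable (fun x : Fin n → Ω => Y (x i)) := fun i => by fun_prop
  have hmp : ∀ i : Fin n, MeasurePreserving (Function.eval i)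
      (Measure.pi (fun _ : Fin n => μ)) μ := measurePreserving_eval _
  have hinti : ∀ i ∈ (Finset.univ : Finset (Fin n)), Integrable
      (fun x : Fin n → Ω => Real.exp (t * Y (x i))) (Measure.pi (fun _ : Fin n => μ)) :=
    fun i _ => (hmp i).integrable_comp_of_integrable hint
  have hmgf : ∀ i : Fin n, mgf (fun x : Fin n → Ω => Y (x i)) (Measure.pi (fun _ : Fin n => μ)) t =
      mgf Y μ t := by
    intro i
    have h := mgf_map (hmp i).aemeasurable (X := Y) (t := t) (by fun_prop)
    rw [(hmp i).map_eq] at h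
    exact h.symm
  have h := measure_ge_le_exp_mul_mgf (n * r) ht (hind.integrable_exp_mul_sum hmeas hinti)
  rw [hind.mgf_sum hmeas] at h
  simp only [hmgf, Finset.prod_const, Finset.card_univ, Fintype.card_fin, Finset.sum_apply] at h
  refine h.trans ?_
  rw [mul_pow, ← Real.exp_nat_mul, show (n : ℝ) * (-t * r) = -t * (n * r) by ring]
  gcongr
  exact mgf_nonneg

/-- Upper deviations of the empirical mean of `(Q² - D²)/4`. -/
theorem pi_measureReal_sq_sub_sq_ge_le {n : ℕ} {Q D : Ω → ℝ} (hQm : Measurable Q)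
    (hDm : Measurable D) {a b : ℝ} (ha : 0 ≤ a) (hb : 0 ≤ b) (hab : a + b = 1)
    (hQ : HasLaw Q (gaussianReal 0 (4 * a).toNNReal) μ)
    (hD : HasLaw D (gaussianReal 0 (4 * b).toNNReal) μ)
    {r : ℝ} (hr : 0 ≤ r) (hr' : r ≤ 1 / 2) :
    (Measure.pi (fun _ : Fin n => μ)).real
        {x | n * r ≤ ∑ i, ((Q (x i) ^ 2 - D (x i) ^ 2) / 4 - (a - b))} ≤
      Real.exp (-(3 / 16 * (n * r ^ 2))) := by
  have hr1 : 0 < 1 + r := by linarith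
  have ht : 0 ≤ r / (2 * (1 + r)) := by positivity
  have ht1 : 1 - 2 * (r / (2 * (1 + r))) = (1 + r)⁻¹ := by field_simp; ring
  have ht' : r / (2 * (1 + r)) < 1 / 2 := by
    have := inv_pos.2 hr1
    linarith
  refine (pi_measureReal_ge_le (Y := fun ω => (Q ω ^ 2 - D ω ^ 2) / 4 - (a - b)) (by fun_prop) ht
    (integrable_exp_sq_sub_sq ha hb hab hQ hD ht ht')
    (mgf_sq_sub_sq_le ha hb hab hQ hD ht ht') r).trans ?_
  rw [show -(3 / 16 * (n * r ^ 2)) = (n : ℝ) * -(3 / 16 * r ^ 2) by ring, Real.exp_nat_mul, ht1,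
    Real.sqrt_inv, inv_inv]
  gcongr
  have hsqrt : √(1 + r) = Real.exp (Real.log (1 + r) / 2) := by
    rw [← Real.log_sqrt hr1.le, Real.exp_log (Real.sqrt_pos.2 hr1)]
  rw [hsqrt, ← Real.exp_add, ← Real.exp_add, Real.exp_le_exp]
  have hsum : r / (2 * (1 + r)) * r + r / (2 * (1 + r)) = r / 2 := by field_simp; ring
  linarith [log_one_add_le_sub_sq hr hr']

/-- Two-sided deviations of the empirical covariance of `f` and `g`, each of unit variance, with
covariance `ρ`. -/
theorem pi_measureReal_abs_mean_mul_sub_ge_le {n : ℕ} (hn : 0 < n) {f g : Ω → ℝ}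
    (hf : Measurable f) (hg : Measurable g) {ρ : ℝ} (hρ : 0 ≤ 2 + 2 * ρ) (hρ' : 0 ≤ 2 - 2 * ρ)
    (hadd : HasLaw (fun ω => f ω + g ω) (gaussianReal 0 (2 + 2 * ρ).toNNReal) μ)
    (hsub : HasLaw (fun ω => f ω - g ω) (gaussianReal 0 (2 - 2 * ρ).toNNReal) μ)
    {r : ℝ} (hr : 0 ≤ r) (hr' : r ≤ 1 / 2) :
    (Measure.pi (fun _ : Fin n => μ)).real
        {x | r ≤ |(∑ i, f (x i) * g (x i)) / n - ρ|} ≤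
      2 * Real.exp (-(3 / 16 * (n * r ^ 2))) := by
  have hn0 : (0 : ℝ) < n := by exact_mod_cast hn
  have ha : 0 ≤ (1 + ρ) / 2 := by linarith
  have hb : 0 ≤ (1 - ρ) / 2 := by linarith
  rw [show 2 + 2 * ρ = 4 * ((1 + ρ) / 2) by ring] at hadd
  rw [show 2 - 2 * ρ = 4 * ((1 - ρ) / 2) by ring] at hsub
  have hup := pi_measureReal_sq_sub_sq_ge_le (n := n) (hf.add hg) (hf.sub hg) ha hb (by ring)
    hadd hsub hr hr'
  have hlow := pi_measureReal_sq_sub_sq_ge_le (n := n) (hf.sub hg) (hf.add hg) hb ha (by ring)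
    hsub hadd hr hr'
  have hsubset : {x : Fin n → Ω | r ≤ |(∑ i, f (x i) * g (x i)) / n - ρ|} ⊆
      {x | n * r ≤ ∑ i, (((f + g) (x i) ^ 2 - (f - g) (x i) ^ 2) / 4 -
          ((1 + ρ) / 2 - (1 - ρ) / 2))} ∪
        {x | n * r ≤ ∑ i, (((f - g) (x i) ^ 2 - (f + g) (x i) ^ 2) / 4 -
          ((1 - ρ) / 2 - (1 + ρ) / 2))} := by
    intro x hx
    rw [Set.mem_ofPred_eq] at hx
    have hpos : ∑ i, (((f + g) (x i) ^ 2 - (f - g) (x i) ^ 2) / 4 -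
        ((1 + ρ) / 2 - (1 - ρ) / 2)) = n * ((∑ i, f (x i) * g (x i)) / n - ρ) := by
      rw [mul_sub, mul_div_cancel₀ _ hn0.ne', Finset.sum_sub_distrib]
      congr 1
      · exact Finset.sum_congr rfl fun i _ => by simp only [Pi.add_apply, Pi.sub_apply]; ring
      · simp; ring
    have hneg : ∑ i, (((f - g) (x i) ^ 2 - (f + g) (x i) ^ 2) / 4 -
        ((1 - ρ) / 2 - (1 + ρ) / 2)) = n * -((∑ i, f (x i) * g (x i)) / n - ρ) := by
      rw [mul_neg, ← hpos, ← Finset.sum_neg_distrib]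
      exact Finset.sum_congr rfl fun i _ => by ring
    simp only [Set.mem_union, Set.mem_ofPred_eq, hpos, hneg]
    exact (le_abs.1 hx).imp (fun h => mul_le_mul_of_nonneg_left h hn0.le)
      (fun h => mul_le_mul_of_nonneg_left h hn0.le)
  calc _ ≤ _ := measureReal_mono hsubset
    _ ≤ _ := measureReal_union_le _ _
    _ ≤ _ := add_le_add hup hlow
    _ = _ := by ring

end Law

theorem sum_sum_single_add_smul_single {p : ℕ} (Sig : Matrix (Fin p) (Fin p) ℝ)
    (hsym : Sig.IsSymm) (hdiag : ∀ j, Sig j j = 1) (j k : Fin p) (e : ℝ) (he : e ^ 2 = 1) :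
    ∑ i, ∑ l, (Pi.single j 1 + Pi.single k e : Fin p → ℝ) i * Sig i l *
      (Pi.single j 1 + Pi.single k e : Fin p → ℝ) l = 2 + 2 * (e * Sig j k) := by
  simp only [Pi.add_apply, Pi.single_apply, add_mul, mul_add, Finset.sum_add_distrib, ite_mul,
    mul_ite, one_mul, zero_mul, mul_one, mul_zero, Finset.sum_ite_eq', Finset.mem_univ, if_true,
    hdiag, hsym.apply j k]
  linear_combination he

/-- Let `X` have i.i.d. rows `N(0, Σ)` (the row law `ν` is characterized by the
fact that every linear functional `⟨a, ·⟩` is Gaussian `N(0, aᵀΣa)`), with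
`Σ_{jj} = 1` for all `j`. If `p < exp(n / (4C₂²))` with `C₂ > 4√(5/3)`, then with
probability at least `1 − 1/p²`, every entry of `Δ = XᵀX/n − Σ` satisfies
`|Δ_{jk}| < C₂ √(log p / n)`. -/
theorem empirical_covariance_entrywise_bound (n p : ℕ) (hn : 0 < n) (hp : 2 ≤ p)
    (Sig : Matrix (Fin p) (Fin p) ℝ) (hsym : Sig.IsSymm) (hPSD : Sig.PosSemidef)
    (hdiag : ∀ j, Sig j j = 1)
    (ν : Measure (Fin p → ℝ)) [IsProbabilityMeasure ν]
    (hν : ∀ a : Fin p → ℝ,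
      ν.map (fun x => ∑ j, a j * x j) =
        gaussianReal 0 (Real.toNNReal (∑ j, ∑ k, a j * Sig j k * a k)))
    (C₂ : ℝ) (hC₂ : 4 * Real.sqrt (5 / 3) < C₂)
    (hpn : (p : ℝ) < Real.exp (n / (4 * C₂ ^ 2))) :
    ENNReal.ofReal (1 - 1 / (p : ℝ) ^ 2) ≤
      Measure.pi (fun _ : Fin n => ν)
        {x : Fin n → Fin p → ℝ |
          ∀ j k : Fin p,
            |(∑ i, x i j * x i k) / n - Sig j k| < C₂ * Real.sqrt (Real.log p / n)} := by
  have hn0 : (0 : ℝ) < n := by exact_mod_cast hn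
  have hp2 : (2 : ℝ) ≤ p := by exact_mod_cast hp
  have hp0 : (0 : ℝ) < p := by linarith
  have hlog : 0 < Real.log p := Real.log_pos (by linarith)
  have hC0 : 0 < C₂ := lt_of_le_of_lt (by positivity) hC₂
  have hCsq : 80 / 3 ≤ C₂ ^ 2 := by
    have hs : √(5 / 3 : ℝ) ^ 2 = 5 / 3 := Real.sq_sqrt (by norm_num)
    nlinarith [Real.sqrt_nonneg (5 / 3 : ℝ)]
  set r := C₂ * Real.sqrt (Real.log p / n) with hr_def
  have hr : 0 ≤ r := by positivity
  have hr_sq : n * r ^ 2 = C₂ ^ 2 * Real.log p := by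
    rw [hr_def, mul_pow, Real.sq_sqrt (by positivity)]
    field_simp
  have hr' : r ≤ 1 / 2 := by
    have hlt : Real.log p < n / (4 * C₂ ^ 2) := (Real.log_lt_iff_lt_exp hp0).2 hpn
    rw [lt_div_iff₀ (by positivity)] at hlt
    have : r ^ 2 ≤ (1 / 2) ^ 2 := by nlinarith
    exact le_of_sq_le_sq this (by norm_num)
  have hlaw : ∀ (j k : Fin p) (e : ℝ), e ^ 2 = 1 →
      HasLaw (fun x : Fin p → ℝ => x j + e * x k)
        (gaussianReal 0 (2 + 2 * (e * Sig j k)).toNNReal) ν := by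
    intro j k e he
    refine ⟨by fun_prop, ?_⟩
    rw [← sum_sum_single_add_smul_single Sig hsym hdiag j k e he, ← hν]
    congr 1
    ext x
    simp [Pi.single_apply, add_mul, Finset.sum_add_distrib]
  have hnonneg : ∀ (j k : Fin p) (e : ℝ), e ^ 2 = 1 → 0 ≤ 2 + 2 * (e * Sig j k) := by
    intro j k e he
    rw [← sum_sum_single_add_smul_single Sig hsym hdiag j k e he]
    have h := hPSD.dotProduct_mulVec_nonneg (Pi.single j 1 + Pi.single k e : Fin p → ℝ)
    simpa only [dotProduct, Matrix.mulVec, Finset.mul_sum, star_trivial, mul_assoc] using h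
  have hentry : ∀ j k : Fin p, (Measure.pi (fun _ : Fin n => ν)).real
      {x | r ≤ |(∑ i, x i j * x i k) / n - Sig j k|} ≤ 2 * ((p : ℝ) ^ 5)⁻¹ := by
    intro j k
    have hadd := hlaw j k 1 (by norm_num)
    have hsub := hlaw j k (-1) (by norm_num)
    have hadd0 := hnonneg j k 1 (by norm_num)
    have hsub0 := hnonneg j k (-1) (by norm_num)
    simp only [one_mul, neg_mul, mul_neg, ← sub_eq_add_neg] at hadd hsub hadd0 hsub0
    refine (pi_measureReal_abs_mean_mul_sub_ge_le hn (measurable_pi_apply j)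
      (measurable_pi_apply k) hadd0 hsub0 hadd hsub hr hr').trans ?_
    have hexp : Real.exp (-(5 * Real.log p)) = ((p : ℝ) ^ 5)⁻¹ := by
      rw [Real.exp_neg, show (5 : ℝ) * Real.log p = (5 : ℕ) * Real.log p by norm_num,
        Real.exp_nat_mul, Real.exp_log hp0]
    rw [← hexp, hr_sq]
    refine mul_le_mul_of_nonneg_left (Real.exp_le_exp.2 ?_) zero_le_two
    nlinarith
  set S := {x : Fin n → Fin p → ℝ |
    ∀ j k : Fin p, |(∑ i, x i j * x i k) / n - Sig j k| < r} with hS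
  have hSm : MeasurableSet S := by
    simp only [hS, Set.ofPred_forall]
    refine MeasurableSet.iInter fun j => MeasurableSet.iInter fun k => ?_
    exact measurableSet_lt (by fun_prop) measurable_const
  have hcompl : Sᶜ = ⋃ j : Fin p, ⋃ k : Fin p,
      {x | r ≤ |(∑ i, x i j * x i k) / n - Sig j k|} := by
    ext x
    simp [hS]
  have hbad : (Measure.pi (fun _ : Fin n => ν)).real Sᶜ ≤ 1 / (p : ℝ) ^ 2 := by
    rw [hcompl]
    calc _ ≤ ∑ j : Fin p, ∑ k : Fin p, 2 * ((p : ℝ) ^ 5)⁻¹ :=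
          (measureReal_iUnion_fintype_le _).trans (Finset.sum_le_sum fun j _ =>
            (measureReal_iUnion_fintype_le _).trans (Finset.sum_le_sum fun k _ => hentry j k))
      _ = 2 / p * (1 / (p : ℝ) ^ 2) := by
          simp only [Finset.sum_const, Finset.card_univ, Fintype.card_fin, nsmul_eq_mul]
          field_simp
      _ ≤ 1 * (1 / (p : ℝ) ^ 2) := by
          gcongr
          rwa [div_le_one hp0]
      _ = _ := one_mul _
  rw [probReal_compl_eq_one_sub hSm] at hbad
  refine ENNReal.ofReal_le_of_le_toReal ?_
  change _ ≤ (Measure.pi (fun _ : Fin n => ν)).real S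
  linarith
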